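/- Fix integers p, q with 1 + |p| < |q| and gcd(p, q) = 1, and let t = x² + px − q ∈ ℤ[x]. Then for every nonzero integer m, neither the language { w ∈ Dom_{p,q} : ∃ k ∈ ℤ, t ∣ (P(w) − km) } nor the language { w ∈ Dom_{p,q} : ∃ k ∈ ℤ, t ∣ (P(w) − km·x) } is regular. (Equivalently, none of the cyclic subgroups ⟨mξ⟩ and ⟨mη⟩ of ℤ² is FA-recognizable with respect to ψ_{p,q}.) -/

import Mathlib

open Polynomial

/-- The alphabet `Σ_q`: integers of absolute value at most `|q| − 1`. -/
def NSAlph (q : ℤ) : Type := {a : ℤ // |a| < |q|}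

/-- The polynomial `P(w) = a₀ + a₁x + ⋯ + a_nxⁿ` represented by the string `w = a₀a₁…a_n`. -/
noncomputable def NSpoly {q : ℤ} : List (NSAlph q) → Polynomial ℤ
  | [] => 0
  | a :: w => C a.val + X * NSpoly w

/-- Two strings are equivalent if `t = X² + pX − q` divides the difference of the
polynomials they represent. -/
def NSequiv (p q : ℤ) (u v : List (NSAlph q)) : Prop :=
  (X ^ 2 + C p * X - C q) ∣ (NSpoly u - NSpoly v)

/-- The length-lexicographic order on strings over `Σ_q`. -/
def NSllex {q : ℤ} (u v : List (NSAlph q)) : Prop :=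
  u.length < v.length ∨
    (u.length = v.length ∧ List.Lex (fun a b : NSAlph q => a.val < b.val) u v)

/-- The domain of the Nies–Semukhin presentation `ψ_{p,q}`: strings that are
length-lexicographically minimal in their equivalence class. -/
def NSDom (p q : ℤ) : Language (NSAlph q) :=
  { w | ∀ u, NSllex u w → ¬ NSequiv p q u w }


/-- The polynomial `t = X² + pX − q`. -/
noncomputable def NSt (p q : ℤ) : ℤ[X] := X ^ 2 + C p * X - C q

lemma NSt_monic (p q : ℤ) : (NSt p q).Monic := by
  unfold NSt
  monicity!

lemma NSt_dvd_of_dvd_C_mul {p q c : ℤ} (hc : c ≠ 0) {s : ℤ[X]} (h : NSt p q ∣ C c * s) :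
    NSt p q ∣ s := by
  rw [← modByMonic_eq_zero_iff_dvd (NSt_monic p q), ← smul_eq_C_mul, smul_modByMonic,
    smul_eq_zero] at h
  exact (modByMonic_eq_zero_iff_dvd (NSt_monic p q)).1 (h.resolve_left hc)

lemma NSt_dvd_of_dvd_X_mul {p q : ℤ} (hq : q ≠ 0) {s : ℤ[X]} (h : NSt p q ∣ X * s) :
    NSt p q ∣ s := by
  obtain ⟨r, hr⟩ := h
  have h0 := congrArg (eval 0) hr
  simp [NSt, hq] at h0
  obtain ⟨r', rfl⟩ : X ∣ r := X_dvd_iff.2 (by rw [coeff_zero_eq_eval_zero, h0])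
  exact ⟨r', mul_left_cancel₀ (X_ne_zero (R := ℤ)) (by rw [hr]; ring)⟩

lemma NSt_dvd_of_dvd_X_pow_mul {p q : ℤ} (hq : q ≠ 0) {s : ℤ[X]} (n : ℕ)
    (h : NSt p q ∣ X ^ n * s) : NSt p q ∣ s := by
  induction n with
  | zero => simpa using h
  | succ n ih => exact ih (NSt_dvd_of_dvd_X_mul hq (by convert h using 1; ring))

/-- No positive power of the class of `x` modulo `t` is rational. -/
lemma eq_zero_of_NSt_dvd {p q : ℤ} (hq : 1 < |q|) (hgcd : Int.gcd p q = 1) {d : ℕ} (hd : d ≠ 0)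
    {a b : ℤ} (h : NSt p q ∣ C a * X ^ d - C b) : a = 0 := by
  have hq0 : q ≠ 0 := by rintro rfl; simp at hq
  have key : ∀ (n : ℕ) (a b : ℤ), NSt p q ∣ C a * X ^ d - C b → q ^ n ∣ a := by
    intro n
    induction n with
    | zero => simp
    | succ n ih =>
      intro a b h
      have h0 : q ∣ b := by
        simpa [NSt, hd] using eval_dvd (x := (0 : ℤ)) h
      have h1 : q ∣ a * (-p) ^ d - b := by
        have := eval_dvd (x := -p) h
        have e : eval (-p) (NSt p q) = -q := by
          simp [NSt]
          ring
        rw [e] at this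
        simpa using this
      have h2 : q ∣ a * (-p) ^ d := (dvd_sub_left h0).1 h1
      have hcop : IsCoprime q ((-p) ^ d) :=
        ((Int.isCoprime_iff_gcd_eq_one.2 hgcd).symm.neg_right).pow_right
      obtain ⟨a', rfl⟩ := hcop.dvd_of_dvd_mul_right h2
      obtain ⟨b', rfl⟩ := h0
      rw [pow_succ']
      refine mul_dvd_mul_left _ (ih a' b' (NSt_dvd_of_dvd_C_mul hq0 ?_))
      convert h using 1
      simp only [map_mul]
      ring
  by_contra ha
  have hf : FiniteMultiplicity q a := by
    rw [Int.finiteMultiplicity_iff]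
    refine ⟨fun h1 => ?_, ha⟩
    have : |q| = 1 := by rw [Int.abs_eq_natAbs, h1]; rfl
    omega
  obtain ⟨n, hn⟩ := hf
  exact hn (key _ a b h)

lemma eq_zero_of_NSt_dvd_C {p q : ℤ} (hq : 1 < |q|) (hgcd : Int.gcd p q = 1) {a : ℤ}
    (h : NSt p q ∣ C a) : a = 0 :=
  eq_zero_of_NSt_dvd hq hgcd one_ne_zero (b := 0) (by simpa using h.mul_right X)

instance NSAlph.finite (q : ℤ) : Finite (NSAlph q) := by
  have : Set.Finite {a : ℤ | |a| < |q|} :=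
    (Set.finite_Ioo (-|q|) |q|).subset fun a ha => abs_lt.1 ha
  exact this.to_subtype

lemma NSpoly_append {q : ℤ} (u v : List (NSAlph q)) :
    NSpoly (u ++ v) = NSpoly u + X ^ u.length * NSpoly v := by
  induction u with
  | nil => simp [NSpoly]
  | cons a u ih => simp only [List.cons_append, NSpoly, ih, List.length_cons]; ring

/-- Every element of `ℤ[X] / (t)` is represented by a string. -/
lemma exists_NSpoly {p q : ℤ} (hpq : 1 + |p| < |q|) (u v : ℤ) :
    ∃ w : List (NSAlph q), NSt p q ∣ NSpoly w - (C u + C v * X) := by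
  induction hN : 2 * u.natAbs + 3 * v.natAbs using Nat.strong_induction_on generalizing u v with
  | _ N ih =>
  by_cases h0 : u = 0 ∧ v = 0
  · obtain ⟨rfl, rfl⟩ := h0
    exact ⟨[], by simp [NSpoly]⟩
  have hq0 : q ≠ 0 := by
    rintro rfl
    have := abs_nonneg p
    simp at hpq
    omega
  have hc : |u.tmod q| < |q| := by
    rw [Int.abs_eq_natAbs, Int.abs_eq_natAbs, Int.natAbs_tmod]
    exact_mod_cast Nat.mod_lt _ (Int.natAbs_pos.2 hq0)
  have hu := Int.tmod_add_mul_tdiv u q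
  have habs : |u| = |u.tmod q| + |q| * |u.tdiv q| := by
    simp only [Int.abs_eq_natAbs, Int.natAbs_tmod, Int.natAbs_tdiv]
    exact_mod_cast (Nat.mod_add_div _ _).symm
  generalize u.tmod q = c at *
  generalize u.tdiv q = b at *
  have hlt : 2 * (v + p * b).natAbs + 3 * b.natAbs < N := by
    have h1 : |v + p * b| ≤ |v| + |p| * |b| := by
      rw [← abs_mul]
      exact abs_add_le _ _
    have h2 : (|p| + 2) * |b| ≤ |q| * |b| :=
      mul_le_mul_of_nonneg_right (by omega) (abs_nonneg b)
    have h3 : c ≠ 0 ∨ b ≠ 0 ∨ v ≠ 0 := by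
      by_contra! h
      obtain ⟨rfl, rfl, rfl⟩ := h
      simp at hu
      exact h0 ⟨hu.symm, rfl⟩
    have h4 : 0 < |c| + |b| + |v| := by
      rcases h3 with h | h | h <;> have := abs_pos.2 h <;> positivity
    have := abs_nonneg c
    have := abs_nonneg b
    have := abs_nonneg v
    zify
    rw [← hN]
    push_cast
    nlinarith
  obtain ⟨w, s, hs⟩ := ih _ hlt (v + p * b) b rfl
  refine ⟨⟨c, hc⟩ :: w, X * s + C b, ?_⟩
  change C c + X * NSpoly w - _ = _
  rw [← hu, sub_eq_iff_eq_add.1 hs]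
  simp only [NSt, map_add, map_mul]
  ring

lemma NSllex_eq_shortlex {q : ℤ} :
    (NSllex : List (NSAlph q) → List (NSAlph q) → Prop) =
      List.Shortlex fun a b : NSAlph q => a.val < b.val := by
  funext u v
  exact propext List.shortlex_def.symm

lemma NSllex_wf (q : ℤ) : WellFounded (NSllex : List (NSAlph q) → List (NSAlph q) → Prop) := by
  rw [NSllex_eq_shortlex]
  refine List.Shortlex.wf ?_
  have : IsTrans (NSAlph q) fun a b => a.val < b.val := ⟨fun _ _ _ => lt_trans⟩
  have : Std.Irrefl fun a b : NSAlph q => a.val < b.val := ⟨fun _ => lt_irrefl _⟩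
  exact Finite.wellFounded_of_trans_of_irrefl _

lemma NSllex_total {q : ℤ} {u v : List (NSAlph q)} (h : u ≠ v) : NSllex u v ∨ NSllex v u := by
  have : Std.Trichotomous fun a b : NSAlph q => a.val < b.val :=
    ⟨fun a b h1 h2 => Subtype.ext (le_antisymm (not_lt.1 h2) (not_lt.1 h1))⟩
  rw [NSllex_eq_shortlex]
  by_contra! hn
  exact h (Std.Trichotomous.trichotomous (r := List.Shortlex _) u v hn.1 hn.2)

lemma NSequiv_symm {p q : ℤ} {u v : List (NSAlph q)} (h : NSequiv p q u v) : NSequiv p q v u := by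
  unfold NSequiv at *
  rwa [dvd_sub_comm]

lemma NSDom_eq_of_NSequiv {p q : ℤ} {u v : List (NSAlph q)} (hu : u ∈ NSDom p q)
    (hv : v ∈ NSDom p q) (h : NSequiv p q u v) : u = v := by
  by_contra hne
  rcases NSllex_total hne with hl | hl
  · exact hv u hl h
  · exact hu v hl (NSequiv_symm h)

lemma NSDom_of_append {p q : ℤ} {u v : List (NSAlph q)} (h : u ++ v ∈ NSDom p q) :
    v ∈ NSDom p q := by
  intro v' hlt heq
  refine h (u ++ v') ?_ ?_
  · rw [NSllex_eq_shortlex] at *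
    exact hlt.append_left u
  · unfold NSequiv at *
    rw [NSpoly_append, NSpoly_append, add_sub_add_left_eq_sub, ← mul_sub]
    exact heq.mul_left _

lemma exists_mem_NSDom {p q : ℤ} (hpq : 1 + |p| < |q|) (u v : ℤ) :
    ∃ w ∈ NSDom p q, NSt p q ∣ NSpoly w - (C u + C v * X) := by
  obtain ⟨w, hw, hmin⟩ := (NSllex_wf q).has_min
    {w | NSt p q ∣ NSpoly w - (C u + C v * X)} (exists_NSpoly hpq u v)
  refine ⟨w, fun w' hlt heq => hmin w' ?_ hlt, hw⟩
  have := dvd_add (show NSt p q ∣ _ from heq) hw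
  rwa [sub_add_sub_cancel] at this

/-- The representatives in the domain of the multiples of `m xᵉ`. -/
def NSmultiples (p q m : ℤ) (e : ℕ) : Language (NSAlph q) :=
  {w ∈ NSDom p q | ∃ k : ℤ, NSt p q ∣ NSpoly w - C (k * m) * X ^ e}

lemma exists_two_extensions {p q m : ℤ} {e : ℕ} (hpq : 1 + |p| < |q|) (hgcd : Int.gcd p q = 1)
    (hm : m ≠ 0) (he : e ≤ 1) (n : ℕ) :
    ∃ u v v' : List (NSAlph q), u.length = n ∧ v ≠ v' ∧
      u ++ v ∈ NSmultiples p q m e ∧ u ++ v' ∈ NSmultiples p q m e := by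
  have hq : 1 < |q| := by have := abs_nonneg p; omega
  have hq0 : q ≠ 0 := by rintro rfl; simp at hq
  have hex : ∀ k : ℤ, ∃ w ∈ NSDom p q, NSt p q ∣ NSpoly w - C (k * m) * X ^ e := by
    intro k
    interval_cases e
    · simpa using exists_mem_NSDom hpq (k * m) 0
    · simpa using exists_mem_NSDom hpq 0 (k * m)
  choose w hwD hw using hex
  have hinj : Function.Injective w := by
    intro k l hkl
    have h := dvd_sub (hw l) (hkl ▸ hw k)
    rw [sub_sub_sub_cancel_left, ← sub_mul, ← C_sub, mul_comm] at h
    have := eq_zero_of_NSt_dvd_C hq hgcd (NSt_dvd_of_dvd_X_pow_mul hq0 e h)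
    rw [← sub_mul] at this
    exact sub_eq_zero.1 ((mul_eq_zero.1 this).resolve_right hm)
  have := (List.finite_length_le (NSAlph q) n).to_subtype
  obtain ⟨k, l, hne, heq⟩ := Finite.exists_ne_map_eq_of_infinite fun k : ℤ =>
    (⟨(w k).take n, List.length_take_le _ _⟩ : {u : List (NSAlph q) | u.length ≤ n})
  have heq : (w k).take n = (w l).take n := congrArg Subtype.val heq
  have hk := List.take_append_drop n (w k)
  have hl := List.take_append_drop n (w l)
  rw [← heq] at hl
  have hdrop : (w k).drop n ≠ (w l).drop n := fun h =>
    hne (hinj (by rw [← hk, ← hl, h]))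
  refine ⟨(w k).take n, (w k).drop n, (w l).drop n, ?_, hdrop, ?_, ?_⟩
  · have h1 := congrArg List.length heq
    by_contra hlen
    simp only [List.length_take] at h1 hlen
    exact hdrop (by rw [List.drop_eq_nil_of_le (by omega), List.drop_eq_nil_of_le (by omega)])
  · rw [hk]
    exact ⟨hwD k, k, hw k⟩
  · rw [hl]
    exact ⟨hwD l, l, hw l⟩

lemma exists_dvd_of_append_mem {p q m : ℤ} {e : ℕ} {u v v' : List (NSAlph q)}
    (h : u ++ v ∈ NSmultiples p q m e) (h' : u ++ v' ∈ NSmultiples p q m e) :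
    ∃ a : ℤ, NSt p q ∣ X ^ u.length * (NSpoly v - NSpoly v') - C a * X ^ e := by
  obtain ⟨-, k, hk⟩ := h
  obtain ⟨-, l, hl⟩ := h'
  refine ⟨k * m - l * m, ?_⟩
  convert dvd_sub hk hl using 1
  rw [NSpoly_append, NSpoly_append, C_sub]
  ring

lemma leftQuotient_ne_of_length_lt {p q m : ℤ} {e : ℕ} (hq : 1 < |q|) (hgcd : Int.gcd p q = 1)
    {u u' v v' : List (NSAlph q)} (hlt : u.length < u'.length) (hne : v ≠ v')
    (h : u ++ v ∈ NSmultiples p q m e) (h' : u ++ v' ∈ NSmultiples p q m e) :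
    (NSmultiples p q m e).leftQuotient u ≠ (NSmultiples p q m e).leftQuotient u' := by
  have hq0 : q ≠ 0 := by rintro rfl; simp at hq
  intro heq
  have hv : u' ++ v ∈ NSmultiples p q m e :=
    (Set.ext_iff.1 heq v).1 h
  have hv' : u' ++ v' ∈ NSmultiples p q m e :=
    (Set.ext_iff.1 heq v').1 h'
  obtain ⟨a, ha⟩ := exists_dvd_of_append_mem h h'
  obtain ⟨b, hb⟩ := exists_dvd_of_append_mem hv hv'
  obtain ⟨d, hd⟩ := Nat.exists_eq_add_of_lt hlt
  have hab : NSt p q ∣ C a * X ^ (d + 1) - C b := by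
    refine NSt_dvd_of_dvd_X_pow_mul hq0 e ?_
    convert dvd_sub hb (ha.mul_left (X ^ (d + 1))) using 1
    rw [hd]
    ring
  obtain rfl := eq_zero_of_NSt_dvd hq hgcd d.succ_ne_zero hab
  rw [C_0, zero_mul, sub_zero] at ha
  exact hne (NSDom_eq_of_NSequiv (NSDom_of_append h.1) (NSDom_of_append h'.1)
    (NSt_dvd_of_dvd_X_pow_mul hq0 _ ha))

lemma NSmultiples_not_isRegular {p q m : ℤ} {e : ℕ} (hpq : 1 + |p| < |q|)
    (hgcd : Int.gcd p q = 1) (hm : m ≠ 0) (he : e ≤ 1) :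
    ¬ (NSmultiples p q m e).IsRegular := by
  intro hreg
  have hq : 1 < |q| := by have := abs_nonneg p; omega
  have := hreg.finite_range_leftQuotient.to_subtype
  choose u v v' hlen hne hv hv' using
    exists_two_extensions (p := p) (q := q) hpq hgcd hm he
  obtain ⟨i, j, hij, heq⟩ := Finite.exists_ne_map_eq_of_infinite fun n =>
    (⟨_, u n, rfl⟩ : Set.range (NSmultiples p q m e).leftQuotient)
  have heq := congrArg Subtype.val heq
  rcases lt_or_gt_of_ne hij with hlt | hlt
  · exact leftQuotient_ne_of_length_lt hq hgcd (by simpa [hlen]) (hne i) (hv i) (hv' i) heq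
  · exact leftQuotient_ne_of_length_lt hq hgcd (by simpa [hlen]) (hne j) (hv j) (hv' j) heq.symm

/-- For every nonzero integer `m`, neither the cyclic subgroup `⟨mξ⟩` nor `⟨mη⟩` of `ℤ²`
is FA-recognizable with respect to `ψ_{p,q}` (where `1 + |p| < |q|` and `gcd(p,q) = 1`):
the corresponding languages of strings in `Dom_{p,q}` are not regular. -/
theorem L_m_xi_eta_not_regular (p q : ℤ) (hpq : 1 + |p| < |q|) (hgcd : Int.gcd p q = 1)
    (m : ℤ) (hm : m ≠ 0) :
    ¬ Language.IsRegular
      { w ∈ NSDom p q | ∃ k : ℤ, (X ^ 2 + C p * X - C q) ∣ (NSpoly w - C (k * m)) } ∧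
    ¬ Language.IsRegular
      { w ∈ NSDom p q | ∃ k : ℤ, (X ^ 2 + C p * X - C q) ∣ (NSpoly w - C (k * m) * X) } := by
  refine ⟨?_, ?_⟩
  · simpa [NSmultiples, NSt] using
      NSmultiples_not_isRegular (e := 0) hpq hgcd hm zero_le_one
  · simpa [NSmultiples, NSt] using
      NSmultiples_not_isRegular (e := 1) hpq hgcd hm le_rfl
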